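/- arXiv:1801.04956 — 2 statements merged into one kernel-verified Lean document; each statement's English description precedes it below -/
import Mathlib

section
/- Let I be the ideal of R generated by x2^{a12}x3^{a13}, x2^{a2} − x1^{a21}x4^{a24}, x3^{a3}, x4^{a4}, x3^{a13}x4^{a24}. Then the sequence 0 → R^2 →(φ3) R^6 →(φ2) R^5 →(φ1) R → R/I → 0 is exact, and it is a minimal free resolution of R/I. Here φ1 = (x2^{a12}x3^{a13}, x2^{a2}−x1^{a21}x4^{a24}, x3^{a3}, x4^{a4}, x3^{a13}x4^{a24}); φ2 is the 5×6 matrix with rows (x4^{a24}, x3^{a43}, x2^{a32}, 0, 0, 0), (0, 0, −x3^{a13}, 0, 0, −x4^{a4}), (0, −x2^{a12}, 0, 0, −x4^{a24}, 0), (0, 0, 0, −x3^{a13}, 0, x2^{a2}−x1^{a21}x4^{a24}), (−x2^{a12}, 0, −x1^{a21}, x4^{a34}, x3^{a43}, 0); and φ3 is the 6×2 matrix with rows (x3^{a43}, x2^{a32}x4^{a34}), (−x4^{a24}, 0), (0, −x4^{a4}), (0, x2^{a2}−x1^{a21}x4^{a24}), (x2^{a12}, 0), (0, x3^{a13}). 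-/
open MvPolynomial Matrix

section MonomialIdeals

variable {σ k : Type*} [Field k]

theorem MvPolynomial.isRelPrime_X_pow_of_not_dvd {i : σ} {p : MvPolynomial σ k}
    (h : ¬ X i ∣ p) (n : ℕ) : IsRelPrime (X i ^ n) p :=
  ((X_prime (R := k) (i := i)).irreducible.isRelPrime_iff_not_dvd.2 h).pow_left

theorem MvPolynomial.not_X_dvd_X_pow {i j : σ} (hij : i ≠ j) (n : ℕ) :
    ¬ (X i : MvPolynomial σ k) ∣ X j ^ n := by
  intro h
  have := (X_prime (R := k) (i := i)).dvd_of_dvd_pow h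
  rw [X_dvd_X] at this
  exact hij this

theorem MvPolynomial.exists_eq_mul_of_X_pow_mul_eq {i : σ} {p v w : MvPolynomial σ k}
    (hp : ¬ X i ∣ p) {n : ℕ} (h : X i ^ n * v = p * w) :
    ∃ z, w = X i ^ n * z ∧ v = p * z := by
  obtain ⟨z, rfl⟩ := (isRelPrime_X_pow_of_not_dvd hp n).dvd_of_dvd_mul_left ⟨v, h.symm⟩
  refine ⟨z, rfl, mul_left_cancel₀ (pow_ne_zero n (X_ne_zero i)) ?_⟩
  linear_combination h

theorem MvPolynomial.mem_span_X_pow_pair_of_X_pow_mul_mem {i j l : σ} (hij : i ≠ j) (hil : i ≠ l)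
    {a b c : ℕ} {v : MvPolynomial σ k}
    (h : X i ^ a * v ∈ Ideal.span {X j ^ b, X l ^ c}) :
    v ∈ Ideal.span {X j ^ b, X l ^ c} := by
  have key : ({X j ^ b, X l ^ c} : Set (MvPolynomial σ k)) =
      (fun s => monomial s (1 : k)) '' {Finsupp.single j b, Finsupp.single l c} := by
    simp [Set.image_pair, X_pow_eq_monomial]
  rw [key, mem_ideal_span_monomial_image] at h ⊢
  intro m hm
  have hm' : Finsupp.single i a + m ∈ (X i ^ a * v).support := by
    rw [mem_support_iff] at hm ⊢
    rwa [X_pow_eq_monomial, coeff_monomial_mul, one_mul]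
  obtain ⟨s, hs, hsm⟩ := h _ hm'
  refine ⟨s, hs, ?_⟩
  rcases hs with rfl | rfl
  · have := hsm j
    simpa [Finsupp.single_le_iff, Finsupp.single_eq_of_ne, hij, hij.symm] using this
  · have := hsm l
    simpa [Finsupp.single_le_iff, Finsupp.single_eq_of_ne, hil, hil.symm] using this

theorem MvPolynomial.exists_koszul_of_X_pow_relation {i j l : σ} (hij : i ≠ j) (hil : i ≠ l)
    (hjl : j ≠ l) {a b c : ℕ} {u v w : MvPolynomial σ k}
    (h : X i ^ a * u + X j ^ b * v + X l ^ c * w = 0) :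
    ∃ x y z, u = X j ^ b * y + X l ^ c * x ∧ v = -X i ^ a * y - X l ^ c * z ∧
      w = -X i ^ a * x + X j ^ b * z := by
  have hu : u ∈ Ideal.span {X j ^ b, X l ^ c} := by
    refine mem_span_X_pow_pair_of_X_pow_mul_mem (a := a) hij hil ?_
    exact Ideal.mem_span_pair.2 ⟨-v, -w, by linear_combination -h⟩
  obtain ⟨y, x, rfl⟩ := Ideal.mem_span_pair.1 hu
  obtain ⟨z, hz, hz'⟩ := exists_eq_mul_of_X_pow_mul_eq (v := -v - X i ^ a * y)
    (w := w + X i ^ a * x) (n := b) (not_X_dvd_X_pow (k := k) hjl c) (by linear_combination -h)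
  exact ⟨x, y, z, by ring, by linear_combination -hz', by linear_combination hz⟩

theorem MvPolynomial.exists_of_X_pow_dvd_binomial_combination {i j l : σ} (hij : i ≠ j)
    (hil : i ≠ l) (hjl : j ≠ l) {a b c d : ℕ} (hc : 0 < c) {f v w : MvPolynomial σ k}
    (h : X j ^ b ∣ (X i ^ a - f * X l ^ c) * v + X l ^ d * w) :
    ∃ p q r, v = X j ^ b * p + X l ^ d * q ∧
      w = -(X i ^ a - f * X l ^ c) * q + X j ^ b * r := by
  obtain ⟨t, ht⟩ := h
  have hv : v ∈ Ideal.span {X j ^ b, X l ^ d} := by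
    refine mem_span_X_pow_pair_of_X_pow_mul_mem (a := a * d) hij hil ?_
    obtain ⟨s, hs⟩ := sub_dvd_pow_sub_pow (X i ^ a) (f * X l ^ c) d
    obtain ⟨r, hr⟩ : (X l ^ d : MvPolynomial σ k) ∣ (f * X l ^ c) ^ d := by
      rw [mul_pow, ← pow_mul]
      exact (pow_dvd_pow _ (Nat.le_mul_of_pos_left d hc)).mul_left _
    refine Ideal.mem_span_pair.2 ⟨s * t, r * v - s * w, ?_⟩
    rw [pow_mul]
    linear_combination -s * ht - v * hs - v * hr
  obtain ⟨p, q, rfl⟩ := Ideal.mem_span_pair.1 hv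
  obtain ⟨r, hr, -⟩ := exists_eq_mul_of_X_pow_mul_eq (i := j)
    (v := t - (X i ^ a - f * X l ^ c) * p) (w := w + (X i ^ a - f * X l ^ c) * q) (n := b)
    (not_X_dvd_X_pow (k := k) hjl d) (by linear_combination -ht)
  exact ⟨p, q, r, by ring, by linear_combination hr⟩

end MonomialIdeals

theorem gorenstein_tangent_cone_resolution_case_2b_stmt7
    (k : Type*) [Field k]
    (a21 a41 a12 a32 a13 a43 a24 a34 a1 a2 a3 a4 : ℕ)
    (h21 : 0 < a21)
    (h41 : 0 < a41)
    (h12 : 0 < a12)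
    (h32 : 0 < a32)
    (h13 : 0 < a13)
    (h43 : 0 < a43)
    (h24 : 0 < a24)
    (h34 : 0 < a34)
    (ha1 : a1 = a21 + a41)
    (ha2 : a2 = a12 + a32)
    (ha3 : a3 = a13 + a43)
    (ha4 : a4 = a24 + a34)
    (hc1 : a12 + a13 < a1)
    (hc2 : a4 < a41 + a43)
    (hc3 : a2 ≤ a21 + a24)
    (hc4 : a3 ≤ a32 + a34)
    (x1 x2 x3 x4 : MvPolynomial (Fin 4) k)
    (hx1 : x1 = X 0) (hx2 : x2 = X 1) (hx3 : x3 = X 2) (hx4 : x4 = X 3)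
    (I m : Ideal (MvPolynomial (Fin 4) k))
    (hI : I = Ideal.span {x2 ^ a12 * x3 ^ a13, x2 ^ a2 - x1 ^ a21 * x4 ^ a24, x3 ^ a3, x4 ^ a4, x3 ^ a13 * x4 ^ a24})
    (hm : m = Ideal.span {x1, x2, x3, x4})
    (g : Fin 5 → MvPolynomial (Fin 4) k)
    (hg : g = ![x2 ^ a12 * x3 ^ a13, x2 ^ a2 - x1 ^ a21 * x4 ^ a24, x3 ^ a3, x4 ^ a4, x3 ^ a13 * x4 ^ a24])
    (φ1 : (Fin 5 → MvPolynomial (Fin 4) k) →ₗ[MvPolynomial (Fin 4) k]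
      MvPolynomial (Fin 4) k)
    (hφ1 : ∀ v, φ1 v = ∑ i, v i * g i)
    (M2 : Matrix (Fin 5) (Fin 6) (MvPolynomial (Fin 4) k))
    (hM2 : M2 = !![x4 ^ a24, x3 ^ a43, x2 ^ a32, 0, 0, 0;
      0, 0, -x3 ^ a13, 0, 0, -x4 ^ a4;
      0, -x2 ^ a12, 0, 0, -x4 ^ a24, 0;
      0, 0, 0, -x3 ^ a13, 0, x2 ^ a2 - x1 ^ a21 * x4 ^ a24;
      -x2 ^ a12, 0, -x1 ^ a21, x4 ^ a34, x3 ^ a43, 0])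
    (M3 : Matrix (Fin 6) (Fin 2) (MvPolynomial (Fin 4) k))
    (hM3 : M3 = !![x3 ^ a43, x2 ^ a32 * x4 ^ a34;
      -x4 ^ a24, 0;
      0, -x4 ^ a4;
      0, x2 ^ a2 - x1 ^ a21 * x4 ^ a24;
      x2 ^ a12, 0;
      0, x3 ^ a13]) :
    Function.Injective ⇑M3.mulVecLin ∧
    Function.Exact ⇑M3.mulVecLin ⇑M2.mulVecLin ∧
    Function.Exact ⇑M2.mulVecLin ⇑φ1 ∧
    LinearMap.range φ1 = I ∧
    Function.Surjective (Ideal.Quotient.mk I) ∧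
    (∀ i, g i ∈ m) ∧ (∀ i j, M2 i j ∈ m) ∧ (∀ i j, M3 i j ∈ m) := by
  subst ha2 ha3 ha4
  have n12 : (1 : Fin 4) ≠ 2 := by decide
  have n13 : (1 : Fin 4) ≠ 3 := by decide
  have n23 : (2 : Fin 4) ≠ 3 := by decide
  have mul3 : ∀ u, M3 *ᵥ u = ![x3 ^ a43 * u 0 + x2 ^ a32 * x4 ^ a34 * u 1, -x4 ^ a24 * u 0,
      -x4 ^ (a24 + a34) * u 1, (x2 ^ (a12 + a32) - x1 ^ a21 * x4 ^ a24) * u 1,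
      x2 ^ a12 * u 0, x3 ^ a13 * u 1] := by
    intro u
    subst hM3
    ext1 i
    fin_cases i <;> simp [Matrix.mulVec, dotProduct, Fin.sum_univ_succ]
  have mul2 : ∀ u, M2 *ᵥ u = ![x4 ^ a24 * u 0 + x3 ^ a43 * u 1 + x2 ^ a32 * u 2,
      -x3 ^ a13 * u 2 - x4 ^ (a24 + a34) * u 5, -x2 ^ a12 * u 1 - x4 ^ a24 * u 4,
      -x3 ^ a13 * u 3 + (x2 ^ (a12 + a32) - x1 ^ a21 * x4 ^ a24) * u 5,
      -x2 ^ a12 * u 0 - x1 ^ a21 * u 2 + x4 ^ a34 * u 3 + x3 ^ a43 * u 4] := by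
    intro u
    subst hM2
    ext1 i
    fin_cases i <;> simp [Matrix.mulVec, dotProduct, Fin.sum_univ_six] <;> ring
  have mul1 : ∀ v, φ1 v = v 0 * (x2 ^ a12 * x3 ^ a13) +
      v 1 * (x2 ^ (a12 + a32) - x1 ^ a21 * x4 ^ a24) + v 2 * x3 ^ (a13 + a43) +
      v 3 * x4 ^ (a24 + a34) + v 4 * (x3 ^ a13 * x4 ^ a24) := by
    intro v
    rw [hφ1, hg]
    simp [Fin.sum_univ_five]
  have hx2n : ∀ n, x2 ^ n ≠ 0 := fun n => hx2 ▸ pow_ne_zero n (X_ne_zero 1)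
  have hx3n : ∀ n, x3 ^ n ≠ 0 := fun n => hx3 ▸ pow_ne_zero n (X_ne_zero 2)
  have hx3g : ¬ x3 ∣ x2 ^ (a12 + a32) - x1 ^ a21 * x4 ^ a24 := by
    subst hx1 hx2 hx3 hx4
    rintro ⟨t, ht⟩
    have := congrArg (MvPolynomial.eval ![0, 1, 0, 0] : MvPolynomial (Fin 4) k →+* k) ht
    simp [h21.ne'] at this
  have inj : Function.Injective ⇑M3.mulVecLin := by
    rw [injective_iff_map_eq_zero]
    intro u hu
    rw [Matrix.mulVecLin_apply, mul3] at hu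
    have e4 : x2 ^ a12 * u 0 = 0 := congrFun hu 4
    have e5 : x3 ^ a13 * u 1 = 0 := congrFun hu 5
    ext1 i
    fin_cases i
    · exact (mul_eq_zero.1 e4).resolve_left (hx2n _)
    · exact (mul_eq_zero.1 e5).resolve_left (hx3n _)
  have ex3 : Function.Exact ⇑M3.mulVecLin ⇑M2.mulVecLin := by
    intro u
    simp only [Matrix.mulVecLin_apply, Set.mem_range]
    constructor
    · intro hu
      rw [mul2] at hu
      have e0 : x4 ^ a24 * u 0 + x3 ^ a43 * u 1 + x2 ^ a32 * u 2 = 0 := congrFun hu 0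
      have e1 : -x3 ^ a13 * u 2 - x4 ^ (a24 + a34) * u 5 = 0 := congrFun hu 1
      have e2 : -x2 ^ a12 * u 1 - x4 ^ a24 * u 4 = 0 := congrFun hu 2
      have e3 : -x3 ^ a13 * u 3 + (x2 ^ (a12 + a32) - x1 ^ a21 * x4 ^ a24) * u 5 = 0 :=
        congrFun hu 3
      obtain ⟨s, hs5, hs3⟩ : ∃ s, u 5 = x3 ^ a13 * s ∧
          u 3 = (x2 ^ (a12 + a32) - x1 ^ a21 * x4 ^ a24) * s := by
        subst hx3
        exact exists_eq_mul_of_X_pow_mul_eq hx3g (by linear_combination -e3)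
      have hs2 : u 2 = -x4 ^ (a24 + a34) * s := by
        apply mul_left_cancel₀ (hx3n a13)
        linear_combination -e1 - x4 ^ (a24 + a34) * hs5
      obtain ⟨t, ht4, ht1⟩ : ∃ t, u 4 = x2 ^ a12 * t ∧ u 1 = -x4 ^ a24 * t := by
        subst hx2 hx4
        obtain ⟨t, h, h'⟩ := exists_eq_mul_of_X_pow_mul_eq (v := -u 1) (w := u 4) (n := a12)
          (not_X_dvd_X_pow (k := k) n13 a24) (by linear_combination e2)
        exact ⟨t, h, by linear_combination -h'⟩
      have ht0 : u 0 = x3 ^ a43 * t + x2 ^ a32 * x4 ^ a34 * s := by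
        have : x4 ^ a24 ≠ 0 := hx4 ▸ pow_ne_zero _ (X_ne_zero 3)
        apply mul_left_cancel₀ this
        linear_combination e0 - x3 ^ a43 * ht1 - x2 ^ a32 * hs2
      refine ⟨![t, s], ?_⟩
      rw [mul3]
      ext1 i
      fin_cases i
      · exact ht0.symm
      · exact ht1.symm
      · exact hs2.symm
      · exact hs3.symm
      · exact ht4.symm
      · exact hs5.symm
    · rintro ⟨w, rfl⟩
      rw [mul3, mul2]
      ext1 i
      fin_cases i <;> simp <;> ring
  have ex2 : Function.Exact ⇑M2.mulVecLin ⇑φ1 := by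
    intro v
    simp only [Matrix.mulVecLin_apply, Set.mem_range]
    constructor
    · intro hv
      rw [mul1] at hv
      obtain ⟨p, q, r, hp, hr⟩ : ∃ p q r, v 1 = x3 ^ a13 * p + x4 ^ (a24 + a34) * q ∧
          v 3 = -(x2 ^ (a12 + a32) - x1 ^ a21 * x4 ^ a24) * q + x3 ^ a13 * r := by
        subst hx2 hx3 hx4
        refine exists_of_X_pow_dvd_binomial_combination n12 n13 n23 h24
          ⟨-(v 0 * X 1 ^ a12 + v 2 * X 2 ^ a43 + v 4 * X 3 ^ a24), ?_⟩
        linear_combination hv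
      have hk : x2 ^ a12 * (v 0 + x2 ^ a32 * p) + x3 ^ a43 * v 2 +
          x4 ^ a24 * (v 4 - x1 ^ a21 * p + x4 ^ a34 * r) = 0 := by
        apply mul_left_cancel₀ (hx3n a13)
        rw [hp, hr] at hv
        linear_combination hv
      obtain ⟨x, y, z, h0, h2, h4⟩ : ∃ x y z, v 0 + x2 ^ a32 * p = x3 ^ a43 * y + x4 ^ a24 * x ∧
          v 2 = -x2 ^ a12 * y - x4 ^ a24 * z ∧
          v 4 - x1 ^ a21 * p + x4 ^ a34 * r = -x2 ^ a12 * x + x3 ^ a43 * z := by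
        subst hx2 hx3 hx4
        exact exists_koszul_of_X_pow_relation n12 n13 n23 hk
      refine ⟨![x, y, -p, -r, z, -q], ?_⟩
      rw [mul2]
      ext1 i
      fin_cases i <;> simp
      · linear_combination -h0
      · linear_combination -hp
      · linear_combination -h2
      · linear_combination -hr
      · linear_combination -h4
    · rintro ⟨u, rfl⟩
      rw [mul2, mul1]
      simp
      ring
  have hrange : LinearMap.range φ1 = I := by
    have hset : ({x2 ^ a12 * x3 ^ a13, x2 ^ (a12 + a32) - x1 ^ a21 * x4 ^ a24,
        x3 ^ (a13 + a43), x4 ^ (a24 + a34), x3 ^ a13 * x4 ^ a24} :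
        Set (MvPolynomial (Fin 4) k)) = Set.range g := by
      subst hg
      simp only [Matrix.range_cons, Matrix.range_empty, Set.union_empty, Set.singleton_union]
    rw [hI, hset]
    ext y
    rw [Ideal.span, Submodule.mem_span_range_iff_exists_fun]
    simp [hφ1]
  have hm1 : x1 ∈ m := hm ▸ Ideal.subset_span (by simp)
  have hm2 : x2 ∈ m := hm ▸ Ideal.subset_span (by simp)
  have hm3 : x3 ∈ m := hm ▸ Ideal.subset_span (by simp)
  have hm4 : x4 ∈ m := hm ▸ Ideal.subset_span (by simp)
  have pw : ∀ {y n}, y ∈ m → 0 < n → y ^ n ∈ m := fun hy hn => m.pow_mem_of_mem hy _ hn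
  have hg2 : x2 ^ (a12 + a32) - x1 ^ a21 * x4 ^ a24 ∈ m :=
    m.sub_mem (pw hm2 (by omega)) (m.mul_mem_left _ (pw hm4 h24))
  have hc : x4 ^ (a24 + a34) ∈ m := pw hm4 (by omega)
  refine ⟨inj, ex3, ex2, hrange, Ideal.Quotient.mk_surjective, ?_, ?_, ?_⟩
  · intro i
    subst hg
    fin_cases i
    · exact m.mul_mem_left _ (pw hm3 h13)
    · exact hg2
    · exact pw hm3 (by omega)
    · exact hc
    · exact m.mul_mem_left _ (pw hm4 h24)
  · intro i j
    subst hM2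
    fin_cases i <;> fin_cases j <;>
      simp [pw hm1 h21, pw hm2 h12, pw hm2 h32, pw hm3 h13, pw hm3 h43, pw hm4 h24, pw hm4 h34,
        hc, hg2]
  · intro i j
    subst hM3
    fin_cases i <;> fin_cases j <;>
      simp [pw hm2 h12, pw hm3 h13, pw hm3 h43, pw hm4 h24, hc, hg2,
        m.mul_mem_left (x2 ^ a32) (pw hm4 h34)]
end

section
/- Let I be the ideal of R generated by x2^{a12}x3^{a13}, x2^{a2} − x1^{a21}x4^{a24}, x3^{a3} − x2^{a32}x4^{a34}, x4^{a4}, x3^{a13}x4^{a24}. Then the sequence 0 → R →(φ3) R^5 →(φ2) R^5 →(φ1) R → R/I → 0 is exact, and it is a minimal free resolution of R/I. Here φ1 = (x2^{a12}x3^{a13}, x2^{a2}−x1^{a21}x4^{a24}, x3^{a3}−x2^{a32}x4^{a34}, x4^{a4}, x3^{a13}x4^{a24}); φ2 is the 5×5 matrix with rows (x4^{a24}, x2^{a32}, x3^{a43}, 0, 0), (0, −x3^{a13}, −x4^{a34}, 0, 0), (0, 0, −x2^{a12}, 0, −x4^{a24}), (0, 0, −x1^{a21}, −x3^{a13}, −x2^{a32}),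 (−x2^{a12}, −x1^{a21}, 0, x4^{a34}, x3^{a43}); and φ3 is the column vector (x3^{a3}−x2^{a32}x4^{a34}, x4^{a4}, −x3^{a13}x4^{a24}, −x2^{a2}+x1^{a21}x4^{a24}, x2^{a12}x3^{a13}). -/
open MvPolynomial Matrix

/-- A power of a variable is a nonzerodivisor modulo powers of two other variables. -/
theorem mem_span_pair_of_mul_X_pow_mem {σ k : Type*} [CommRing k] {i j l : σ}
    (hij : j ≠ i) (hil : l ≠ i) (M p q : ℕ) {f : MvPolynomial σ k}
    (h : f * X i ^ M ∈ Ideal.span {(X j : MvPolynomial σ k) ^ p, X l ^ q}) :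
    f ∈ Ideal.span {(X j : MvPolynomial σ k) ^ p, X l ^ q} := by
  classical
  have hs : ({(X j : MvPolynomial σ k) ^ p, X l ^ q} : Set (MvPolynomial σ k)) =
      (fun s => monomial s (1 : k)) '' {Finsupp.single j p, Finsupp.single l q} := by
    simp [Set.image_pair, X_pow_eq_monomial]
  rw [hs, mem_ideal_span_monomial_image] at h ⊢
  intro e he
  obtain ⟨s, hs, hle⟩ := h (e + Finsupp.single i M) (by
    rw [mem_support_iff] at he ⊢
    rwa [X_pow_eq_monomial, coeff_mul_monomial, mul_one])
  refine ⟨s, hs, ?_⟩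
  rcases hs with rfl | rfl
  · have := hle j
    simp only [Finsupp.single_eq_same, Finsupp.add_apply, Finsupp.single_eq_of_ne hij,
      add_zero] at this
    simpa using this
  · have := hle l
    simp only [Finsupp.single_eq_same, Finsupp.add_apply, Finsupp.single_eq_of_ne hil,
      add_zero] at this
    simpa using this

theorem mem_span_pair_of_mul_X_pow_sub_mem {σ k : Type*} [CommRing k] {i j l : σ}
    (hij : j ≠ i) (hil : l ≠ i) (M N p q : ℕ) {e f : MvPolynomial σ k}
    (he : e ^ N ∈ Ideal.span {(X j : MvPolynomial σ k) ^ p, X l ^ q})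
    (h : f * (X i ^ M - e) ∈ Ideal.span {(X j : MvPolynomial σ k) ^ p, X l ^ q}) :
    f ∈ Ideal.span {(X j : MvPolynomial σ k) ^ p, X l ^ q} := by
  refine mem_span_pair_of_mul_X_pow_mem hij hil (M * N) p q ?_
  obtain ⟨r, hr⟩ := sub_dvd_pow_sub_pow ((X i : MvPolynomial σ k) ^ M) e N
  have : f * X i ^ (M * N) = r * (f * (X i ^ M - e)) + f * e ^ N := by
    rw [pow_mul]
    linear_combination f * hr
  rw [this]
  exact add_mem (Ideal.mul_mem_left _ _ h) (Ideal.mul_mem_left _ _ he)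

theorem X_pow_dvd_of_dvd_X_pow_mul {σ k : Type*} [Field k] {i j : σ} (hij : i ≠ j)
    (p q : ℕ) {f : MvPolynomial σ k} (h : (X i : MvPolynomial σ k) ^ p ∣ X j ^ q * f) :
    (X i : MvPolynomial σ k) ^ p ∣ f := by
  exact X_prime.pow_dvd_of_dvd_mul_left p
    (fun hd => hij (X_dvd_X.1 (X_prime.dvd_of_dvd_pow hd))) h

section Complex

variable {S : Type*} [CommRing S] [IsDomain S] {A b B c C d D : S}

theorem exists_syzygy_coefficients (hc : c ≠ 0) (hd : d ≠ 0)
    (h₁ : ∀ f, f * (c * C - B * D) ∈ Ideal.span {b, d} → f ∈ Ideal.span {b, d})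
    (h₂ : ∀ f, f * (b * B - A * d) ∈ Ideal.span {c, d * D} → f ∈ Ideal.span {c, d * D})
    (h₃ : ∀ f, c ∣ d * D * f → c ∣ f) (h₄ : ∀ f, d ∣ b * f → d ∣ f)
    {v₁ v₂ v₃ v₄ v₅ : S}
    (hv : v₁ * (b * c) + v₂ * (b * B - A * d) + v₃ * (c * C - B * D) + v₄ * (d * D)
      + v₅ * (c * d) = 0) :
    ∃ w₁ w₂ w₃ w₄ w₅ : S, v₁ = d * w₁ + B * w₂ + C * w₃ ∧ v₂ = -c * w₂ - D * w₃ ∧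
      v₃ = -b * w₃ - d * w₅ ∧ v₄ = -A * w₃ - c * w₄ - B * w₅ ∧
      v₅ = -b * w₁ - A * w₂ + D * w₄ + C * w₅ := by
  obtain ⟨s, t, hst⟩ := Ideal.mem_span_pair.1 (h₁ v₃ (Ideal.mem_span_pair.2
    ⟨-(v₁ * c + v₂ * B), v₂ * A - v₄ * D - v₅ * c, by linear_combination -hv⟩))
  obtain ⟨p, q, hpq⟩ := Ideal.mem_span_pair.1 (h₂ (v₂ - s * D) (Ideal.mem_span_pair.2
    ⟨-((v₁ + s * C) * b + (v₅ + t * C) * d), -(v₄ - s * A - t * B), by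
      linear_combination -hv - (c * C - B * D) * hst⟩))
  obtain ⟨r, hr⟩ := h₃ (v₄ - s * A - t * B + q * (b * B - A * d))
    ⟨-((v₁ + s * C + p * B) * b + (v₅ + t * C - p * A) * d), by
      linear_combination hv + (c * C - B * D) * hst + (b * B - A * d) * hpq⟩
  have key : b * (v₁ + s * C + p * B) + d * (v₅ + t * C - p * A + r * D) = 0 := by
    refine (mul_eq_zero.1 ?_).resolve_left hc
    linear_combination hv + (c * C - B * D) * hst + (b * B - A * d) * hpq - d * D * hr
  obtain ⟨z, hz⟩ := h₄ (v₁ + s * C + p * B)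
    ⟨-(v₅ + t * C - p * A + r * D), by linear_combination key⟩
  have hz' : v₅ + t * C - p * A + r * D = -b * z :=
    mul_left_cancel₀ hd (by linear_combination key - b * hz)
  refine ⟨z + q * C, -p, -s - q * d, -r, -t + q * b, ?_, ?_, ?_, ?_, ?_⟩
  · linear_combination hz
  · linear_combination -hpq
  · linear_combination -hst
  · linear_combination hr
  · linear_combination hz'

theorem exists_second_syzygy_coefficient (hc : c ≠ 0) (hd : d ≠ 0) (hb : b ≠ 0)
    (h₃ : ∀ f, c ∣ d * D * f → c ∣ f) (h₅ : ∀ f, b ∣ d * f → b ∣ f)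
    {w₁ w₂ w₃ w₄ w₅ : S} (e₁ : d * w₁ + B * w₂ + C * w₃ = 0) (e₂ : -c * w₂ - D * w₃ = 0)
    (e₃ : -b * w₃ - d * w₅ = 0) (e₄ : -A * w₃ - c * w₄ - B * w₅ = 0) :
    ∃ t, w₁ = (c * C - B * D) * t ∧ w₂ = d * D * t ∧ w₃ = -(c * d) * t ∧
      w₄ = (-(b * B) + A * d) * t ∧ w₅ = b * c * t := by
  obtain ⟨u, hu⟩ := h₅ w₅ ⟨-w₃, by linear_combination -e₃⟩
  have hw₃ : w₃ = -d * u := mul_left_cancel₀ hb (by linear_combination -e₃ - d * hu)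
  obtain ⟨t, ht⟩ := h₃ u ⟨w₂, by linear_combination e₂ + D * hw₃⟩
  subst ht
  have hw₂ : w₂ = d * D * t := mul_left_cancel₀ hc (by linear_combination -e₂ - D * hw₃)
  refine ⟨t, mul_left_cancel₀ hd ?_, hw₂, ?_, mul_left_cancel₀ hc ?_, ?_⟩
  · linear_combination e₁ - B * hw₂ - C * hw₃
  · linear_combination hw₃
  · linear_combination -e₄ - A * hw₃ - B * hu
  · linear_combination hu

end Complex

theorem gorenstein_tangent_cone_resolution_case_2b_stmt9
    (k : Type*) [Field k]
    (a21 a41 a12 a32 a13 a43 a24 a34 a1 a2 a3 a4 : ℕ)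
    (h21 : 0 < a21)
    (h41 : 0 < a41)
    (h12 : 0 < a12)
    (h32 : 0 < a32)
    (h13 : 0 < a13)
    (h43 : 0 < a43)
    (h24 : 0 < a24)
    (h34 : 0 < a34)
    (ha1 : a1 = a21 + a41)
    (ha2 : a2 = a12 + a32)
    (ha3 : a3 = a13 + a43)
    (ha4 : a4 = a24 + a34)
    (hc1 : a12 + a13 < a1)
    (hc2 : a4 < a41 + a43)
    (hc3 : a2 ≤ a21 + a24)
    (hc4 : a3 ≤ a32 + a34)
    (x1 x2 x3 x4 : MvPolynomial (Fin 4) k)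
    (hx1 : x1 = X 0) (hx2 : x2 = X 1) (hx3 : x3 = X 2) (hx4 : x4 = X 3)
    (I m : Ideal (MvPolynomial (Fin 4) k))
    (hI : I = Ideal.span {x2 ^ a12 * x3 ^ a13, x2 ^ a2 - x1 ^ a21 * x4 ^ a24, x3 ^ a3 - x2 ^ a32 * x4 ^ a34, x4 ^ a4, x3 ^ a13 * x4 ^ a24})
    (hm : m = Ideal.span {x1, x2, x3, x4})
    (g : Fin 5 → MvPolynomial (Fin 4) k)
    (hg : g = ![x2 ^ a12 * x3 ^ a13, x2 ^ a2 - x1 ^ a21 * x4 ^ a24, x3 ^ a3 - x2 ^ a32 * x4 ^ a34, x4 ^ a4, x3 ^ a13 * x4 ^ a24])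
    (φ1 : (Fin 5 → MvPolynomial (Fin 4) k) →ₗ[MvPolynomial (Fin 4) k]
      MvPolynomial (Fin 4) k)
    (hφ1 : ∀ v, φ1 v = ∑ i, v i * g i)
    (M2 : Matrix (Fin 5) (Fin 5) (MvPolynomial (Fin 4) k))
    (hM2 : M2 = !![x4 ^ a24, x2 ^ a32, x3 ^ a43, 0, 0;
      0, -x3 ^ a13, -x4 ^ a34, 0, 0;
      0, 0, -x2 ^ a12, 0, -x4 ^ a24;
      0, 0, -x1 ^ a21, -x3 ^ a13, -x2 ^ a32;
      -x2 ^ a12, -x1 ^ a21, 0, x4 ^ a34, x3 ^ a43])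
    (M3 : Matrix (Fin 5) (Fin 1) (MvPolynomial (Fin 4) k))
    (hM3 : M3 = !![x3 ^ a3 - x2 ^ a32 * x4 ^ a34;
      x4 ^ a4;
      -(x3 ^ a13 * x4 ^ a24);
      -x2 ^ a2 + x1 ^ a21 * x4 ^ a24;
      x2 ^ a12 * x3 ^ a13]) :
    Function.Injective ⇑M3.mulVecLin ∧
    Function.Exact ⇑M3.mulVecLin ⇑M2.mulVecLin ∧
    Function.Exact ⇑M2.mulVecLin ⇑φ1 ∧
    LinearMap.range φ1 = I ∧
    Function.Surjective (Ideal.Quotient.mk I) ∧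
    (∀ i, g i ∈ m) ∧ (∀ i j, M2 i j ∈ m) ∧ (∀ i j, M3 i j ∈ m) := by
  subst ha2 ha3 ha4 hx1 hx2 hx3 hx4
  have hX : ∀ (i : Fin 4) (n : ℕ), (X i : MvPolynomial (Fin 4) k) ^ n ≠ 0 := fun i n =>
    pow_ne_zero _ (X_ne_zero i)
  have h₁ : ∀ f : MvPolynomial (Fin 4) k,
      f * (X 2 ^ a13 * X 2 ^ a43 - X 1 ^ a32 * X 3 ^ a34) ∈ Ideal.span {X 1 ^ a12, X 3 ^ a24} →
      f ∈ Ideal.span {X 1 ^ a12, X 3 ^ a24} := fun f hf => by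
    rw [← pow_add] at hf
    refine mem_span_pair_of_mul_X_pow_sub_mem (by decide) (by decide) _ a24 _ _ ?_ hf
    refine Ideal.mem_of_dvd _ ?_ (Ideal.subset_span (Set.mem_insert_of_mem _ rfl))
    rw [mul_pow, ← pow_mul (X 3)]
    exact Dvd.dvd.mul_left (pow_dvd_pow _ (Nat.le_mul_of_pos_left _ h34)) _
  have h₂ : ∀ f : MvPolynomial (Fin 4) k,
      f * (X 1 ^ a12 * X 1 ^ a32 - X 0 ^ a21 * X 3 ^ a24) ∈
        Ideal.span {X 2 ^ a13, X 3 ^ a24 * X 3 ^ a34} →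
      f ∈ Ideal.span {X 2 ^ a13, X 3 ^ a24 * X 3 ^ a34} := fun f hf => by
    rw [← pow_add, ← pow_add] at hf
    rw [← pow_add]
    refine mem_span_pair_of_mul_X_pow_sub_mem (by decide) (by decide) _ (a24 + a34) _ _ ?_ hf
    refine Ideal.mem_of_dvd _ ?_ (Ideal.subset_span (Set.mem_insert_of_mem _ rfl))
    rw [mul_pow, ← pow_mul (X 3)]
    exact Dvd.dvd.mul_left (pow_dvd_pow _ (Nat.le_mul_of_pos_left _ h24)) _
  have h₃ : ∀ f : MvPolynomial (Fin 4) k,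
      X 2 ^ a13 ∣ X 3 ^ a24 * X 3 ^ a34 * f → X 2 ^ a13 ∣ f := fun f hf => by
    rw [← pow_add] at hf
    exact X_pow_dvd_of_dvd_X_pow_mul (by decide) _ _ hf
  have h₄ : ∀ f : MvPolynomial (Fin 4) k, X 3 ^ a24 ∣ X 1 ^ a12 * f → X 3 ^ a24 ∣ f :=
    fun f hf => X_pow_dvd_of_dvd_X_pow_mul (by decide) _ _ hf
  have h₅ : ∀ f : MvPolynomial (Fin 4) k, X 1 ^ a12 ∣ X 3 ^ a24 * f → X 1 ^ a12 ∣ f :=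
    fun f hf => X_pow_dvd_of_dvd_X_pow_mul (by decide) _ _ hf
  have hXm : ∀ (i : Fin 4) {n : ℕ}, 0 < n → (X i : MvPolynomial (Fin 4) k) ^ n ∈ m := by
    intro i n hn
    refine Ideal.pow_mem_of_mem _ ?_ _ hn
    rw [hm]
    apply Ideal.subset_span
    fin_cases i <;> simp
  have hg_mem : ∀ i, g i ∈ m := by
    subst hg
    intro i
    fin_cases i
    · exact Ideal.mul_mem_right _ _ (hXm 1 h12)
    · exact sub_mem (hXm 1 (by lia)) (Ideal.mul_mem_right _ _ (hXm 0 h21))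
    · exact sub_mem (hXm 2 (by lia)) (Ideal.mul_mem_right _ _ (hXm 1 h32))
    · exact hXm 3 (by lia)
    · exact Ideal.mul_mem_right _ _ (hXm 2 h13)
  have hM3_mem : ∀ i j, M3 i j ∈ m := by
    subst hM3
    intro i j
    fin_cases j
    fin_cases i
    · exact sub_mem (hXm 2 (by lia)) (Ideal.mul_mem_right _ _ (hXm 1 h32))
    · exact hXm 3 (by lia)
    · exact neg_mem (Ideal.mul_mem_right _ _ (hXm 2 h13))
    · exact add_mem (neg_mem (hXm 1 (by lia))) (Ideal.mul_mem_right _ _ (hXm 0 h21))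
    · exact Ideal.mul_mem_right _ _ (hXm 1 h12)
  have hM2_mem : ∀ i j, M2 i j ∈ m := by
    subst hM2
    intro i j
    fin_cases i <;> fin_cases j <;> simp [hXm, h21, h12, h32, h13, h43, h24, h34]
  have hM3v : ∀ u : Fin 1 → MvPolynomial (Fin 4) k, M3.mulVecLin u =
      ![(X 2 ^ (a13 + a43) - X 1 ^ a32 * X 3 ^ a34) * u 0, X 3 ^ (a24 + a34) * u 0,
        -(X 2 ^ a13 * X 3 ^ a24) * u 0,
        (-X 1 ^ (a12 + a32) + X 0 ^ a21 * X 3 ^ a24) * u 0, X 1 ^ a12 * X 2 ^ a13 * u 0] := by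
    intro u
    ext1 i
    fin_cases i <;> simp [hM3, Matrix.mulVec, dotProduct]
  have hM2v : ∀ w : Fin 5 → MvPolynomial (Fin 4) k, M2.mulVecLin w =
      ![X 3 ^ a24 * w 0 + X 1 ^ a32 * w 1 + X 2 ^ a43 * w 2,
        -X 2 ^ a13 * w 1 - X 3 ^ a34 * w 2,
        -X 1 ^ a12 * w 2 - X 3 ^ a24 * w 4,
        -X 0 ^ a21 * w 2 - X 2 ^ a13 * w 3 - X 1 ^ a32 * w 4,
        -X 1 ^ a12 * w 0 - X 0 ^ a21 * w 1 + X 3 ^ a34 * w 3 + X 2 ^ a43 * w 4] := by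
    intro w
    ext1 i
    fin_cases i <;> simp [hM2, Matrix.mulVec, dotProduct, Fin.sum_univ_five] <;> ring
  refine ⟨?_, ?_, ?_, ?_, Ideal.Quotient.mk_surjective, hg_mem, hM2_mem, hM3_mem⟩
  · rw [injective_iff_map_eq_zero]
    intro u hu
    have h := congrFun hu 1
    rw [hM3v] at h
    ext1 i
    fin_cases i
    exact (mul_eq_zero.1 h).resolve_left (hX _ _)
  · intro w
    constructor
    · intro hw
      rw [hM2v] at hw
      obtain ⟨t, e₁, e₂, e₃, e₄, e₅⟩ := exists_second_syzygy_coefficient (hX _ _) (hX _ _)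
        (hX _ _) h₃ h₅ (congrFun hw 0) (congrFun hw 1) (congrFun hw 2) (congrFun hw 3)
      refine ⟨fun _ => t, ?_⟩
      rw [hM3v]
      simp only [pow_add]
      ext1 i
      fin_cases i
      exacts [e₁.symm, e₂.symm, e₃.symm, e₄.symm, e₅.symm]
    · rintro ⟨u, rfl⟩
      rw [hM2v, hM3v]
      ext1 i
      fin_cases i <;> simp <;> ring
  · intro v
    rw [hφ1, Fin.sum_univ_five, hg]
    constructor
    · intro hv
      simp only [pow_add] at hv
      obtain ⟨w₁, w₂, w₃, w₄, w₅, e₁, e₂, e₃, e₄, e₅⟩ :=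
        exists_syzygy_coefficients (hX _ _) (hX _ _) h₁ h₂ h₃ h₄ hv
      refine ⟨![w₁, w₂, w₃, w₄, w₅], ?_⟩
      rw [hM2v]
      ext1 i
      fin_cases i
      exacts [e₁.symm, e₂.symm, e₃.symm, e₄.symm, e₅.symm]
    · rintro ⟨w, rfl⟩
      rw [hM2v]
      simp
      ring
  · have hr : Set.range g = {X 1 ^ a12 * X 2 ^ a13, X 1 ^ (a12 + a32) - X 0 ^ a21 * X 3 ^ a24,
        X 2 ^ (a13 + a43) - X 1 ^ a32 * X 3 ^ a34, X 3 ^ (a24 + a34),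
        X 2 ^ a13 * X 3 ^ a24} := by
      rw [hg]
      simp only [Matrix.range_cons, Matrix.range_empty, Set.union_empty, Set.singleton_union]
    rw [hI, ← hr]
    ext f
    rw [LinearMap.mem_range, Ideal.mem_span_range_iff_exists_fun]
    simp only [hφ1]
end
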